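/- arXiv:1906.03162 — 6 statements merged into one kernel-verified Lean document; each statement's English description precedes it below -/
import Mathlib

section
/- A vector d = (d₀, d₁, …, d₈) ∈ Λ is exceptional (i.e. d·d = −1 and d·K = −1) if and only if there is a permutation π of {1, …, 8} such that the vector (d₀, −d_{π(1)}, …, −d_{π(8)}) is one of the following seven vectors: (0, −1, 0, 0, 0, 0, 0, 0, 0), (1, 1, 1, 0, 0, 0, 0, 0, 0), (2, 1, 1, 1, 1, 1, 0, 0, 0), (3, 2, 1, 1, 1, 1, 1, 1, 0), (4, 2, 2, 2, 1, 1, 1, 1, 1), (5, 2, 2, 2, 2, 2, 2, 1, 1), (6, 3, 2, 2, 2, 2, 2, 2, 2). -/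
/-- The bilinear form on `Λ = ℤ⁹`: `d·e = d₀e₀ − Σ_{i=1}^{8} dᵢeᵢ`. -/
def dot (d e : Fin 9 → ℤ) : ℤ := d 0 * e 0 - ∑ i : Fin 8, d i.succ * e i.succ

/-- The canonical class `K = (−3, 1, 1, 1, 1, 1, 1, 1, 1)`. -/
def KK : Fin 9 → ℤ := ![-3, 1, 1, 1, 1, 1, 1, 1, 1]

/-- A vector is exceptional if `d·d = −1` and `d·K = −1`. -/
def IsExceptional (d : Fin 9 → ℤ) : Prop := dot d d = -1 ∧ dot d KK = -1

/-- The seven vectors from the table. -/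
def excVectors : Fin 7 → Fin 9 → ℤ :=
  ![![0, -1, 0, 0, 0, 0, 0, 0, 0],
    ![1, 1, 1, 0, 0, 0, 0, 0, 0],
    ![2, 1, 1, 1, 1, 1, 0, 0, 0],
    ![3, 2, 1, 1, 1, 1, 1, 1, 0],
    ![4, 2, 2, 2, 1, 1, 1, 1, 1],
    ![5, 2, 2, 2, 2, 2, 2, 1, 1],
    ![6, 3, 2, 2, 2, 2, 2, 2, 2]]

theorem isExceptional_iff_sums (d : Fin 9 → ℤ) :
    IsExceptional d ↔
      ∑ i : Fin 8, (-d i.succ) ^ 2 = d 0 ^ 2 + 1 ∧ ∑ i : Fin 8, -d i.succ = 3 * d 0 - 1 := by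
  simp [IsExceptional, dot, KK, Fin.sum_univ_succ, Fin.succ]
  constructor <;> rintro ⟨h₁, h₂⟩ <;> constructor <;> linarith

theorem int_mul_pred_nonneg (y : ℤ) : 0 ≤ y * (y - 1) := by
  rcases le_or_gt y 0 with h | h <;> nlinarith

theorem sum_consecutive_mul (x : Fin 8 → ℤ) (c : ℤ) :
    ∑ i, (x i - c) * (x i - c - 1) =
      ∑ i, x i ^ 2 - (2 * c + 1) * ∑ i, x i + 8 * (c * (c + 1)) := by
  simp only [Fin.sum_univ_eight]
  ring

theorem sum_consecutive_mul_nonneg (x : Fin 8 → ℤ) (c : ℤ) :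
    0 ≤ ∑ i, x i ^ 2 - (2 * c + 1) * ∑ i, x i + 8 * (c * (c + 1)) :=
  sum_consecutive_mul x c ▸ Finset.sum_nonneg fun i _ => int_mul_pred_nonneg (x i - c)

theorem mem_consecutive_of_sums (x : Fin 8 → ℤ) (c : ℤ)
    (h : ∑ i, x i ^ 2 - (2 * c + 1) * ∑ i, x i + 8 * (c * (c + 1)) = 0) (i : Fin 8) :
    c ≤ x i ∧ x i ≤ c + 1 := by
  rw [← sum_consecutive_mul,
    Finset.sum_eq_zero_iff_of_nonneg fun i _ => int_mul_pred_nonneg (x i - c)] at h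
  rcases mul_eq_zero.1 (h i (Finset.mem_univ i)) with h | h <;> omega

/-- Cauchy–Schwarz bounds the degree of an exceptional vector. -/
theorem degree_mem_Icc {x : Fin 8 → ℤ} {n : ℤ} (hq : ∑ i, x i ^ 2 = n ^ 2 + 1)
    (hs : ∑ i, x i = 3 * n - 1) : 0 ≤ n ∧ n ≤ 6 := by
  have h := sq_sum_le_card_mul_sum_sq (s := Finset.univ) (f := x)
  have h₁ := sum_consecutive_mul_nonneg x (-1)
  have h₂ := sum_consecutive_mul_nonneg x 2
  simp only [hq, hs, Finset.card_univ, Fintype.card_fin] at h h₁ h₂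
  push_cast at h
  constructor
  · by_contra! hn
    nlinarith
  · by_contra! hn
    nlinarith

theorem antitone_of_degree_three {x : Fin 8 → ℤ} (hx : Antitone x)
    (hq : ∑ i, x i ^ 2 = 10) (hs : ∑ i, x i = 8) :
    x = ![2, 1, 1, 1, 1, 1, 1, 0] := by
  have hy : ∑ i, (x i - 1) ^ 2 = 2 := by
    simp only [Fin.sum_univ_eight] at *
    linarith
  have hb : ∀ i, 0 ≤ x i ∧ x i ≤ 2 := fun i => by
    have h := Finset.single_le_sum (f := fun i => (x i - 1) ^ 2) (fun i _ => sq_nonneg _)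
      (Finset.mem_univ i)
    simp only [hy] at h
    constructor <;> nlinarith
  have h₀ : x 0 = 2 := by
    refine le_antisymm (hb 0).2 ?_
    by_contra! h
    have hsum := sum_consecutive_mul x 0
    have : ∑ i, (x i - 0) * (x i - 0 - 1) ≤ 0 := Finset.sum_nonpos fun i _ => by
      have := hx (Fin.zero_le i)
      have := hb i
      nlinarith
    omega
  have h₇ : x 7 = 0 := by
    refine le_antisymm ?_ (hb 7).1
    by_contra! h
    have hsum := sum_consecutive_mul x 1
    have : ∑ i, (x i - 1) * (x i - 1 - 1) ≤ 0 := Finset.sum_nonpos fun i _ => by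
      have := hb i
      have : 1 ≤ x i := h.trans_le (hx (Fin.le_last i))
      nlinarith
    omega
  simp only [Fin.sum_univ_eight, h₀, h₇] at hy
  have hmid : ∀ i, (x i - 1) ^ 2 = 0 → x i = 1 := fun i h =>
    sub_eq_zero.1 (pow_eq_zero_iff two_ne_zero |>.1 h)
  have hnn := fun i => sq_nonneg (x i - 1)
  ext i
  fin_cases i
  · exact h₀
  all_goals first
    | exact h₇
    | exact hmid _ (by dsimp; linarith [hnn 1, hnn 2, hnn 3, hnn 4, hnn 5, hnn 6])

theorem exists_perm_monotone_comp (x : Fin 8 → ℤ) :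
    ∃ π : Equiv.Perm (Fin 8), Monotone (x ∘ π) :=
  ⟨_, Tuple.monotone_sort x⟩

theorem exists_perm_antitone_comp (x : Fin 8 → ℤ) :
    ∃ π : Equiv.Perm (Fin 8), Antitone (x ∘ π) := by
  obtain ⟨π, h⟩ := exists_perm_monotone_comp (-x)
  exact ⟨π, fun i j hij => neg_le_neg_iff.1 (h hij)⟩

/-- Coordinates confined to two consecutive values are determined, once sorted, by their sum. -/
theorem antitone_eq_of_consecutive {x y : Fin 8 → ℤ} {c : ℤ} (hx : Antitone x) (hy : Antitone y)
    (hxc : ∀ i, c ≤ x i ∧ x i ≤ c + 1) (hyc : ∀ i, c ≤ y i ∧ y i ≤ c + 1)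
    (h : ∑ i, x i = ∑ i, y i) : x = y := by
  have key : ∀ {x y : Fin 8 → ℤ}, Antitone x → Antitone y → (∀ i, c ≤ x i ∧ x i ≤ c + 1) →
      (∀ i, c ≤ y i ∧ y i ≤ c + 1) → ∑ i, x i = ∑ i, y i → x ≤ y := by
    intro x y hx hy hxc hyc h i
    by_contra! hi
    refine h.not_gt (Finset.sum_lt_sum (fun j _ => ?_) ⟨i, Finset.mem_univ i, hi⟩)
    replace hi : y i < x i := hi
    have := hxc i
    have := hyc i
    have := hxc j
    have := hyc j
    rcases le_total i j with hij | hij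
    · have := hy hij
      omega
    · have := hx hij
      omega
  exact le_antisymm (key hx hy hxc hyc h) (key hy hx hyc hxc h.symm)

theorem antitone_cases {x : Fin 8 → ℤ} {n : ℤ} (hx : Antitone x)
    (hq : ∑ i, x i ^ 2 = n ^ 2 + 1) (hs : ∑ i, x i = 3 * n - 1) (hn : 1 ≤ n) :
    ∃ j, (Fin.cons n x : Fin 9 → ℤ) = excVectors j := by
  have hn6 := (degree_mem_Icc hq hs).2
  have key : ∀ (c : ℤ) (y : Fin 8 → ℤ),
      n ^ 2 + 1 - (2 * c + 1) * (3 * n - 1) + 8 * (c * (c + 1)) = 0 →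
      Antitone y → (∀ i, c ≤ y i ∧ y i ≤ c + 1) → ∑ i, y i = 3 * n - 1 → x = y :=
    fun c y hc hy hyc hsy => antitone_eq_of_consecutive hx hy
      (mem_consecutive_of_sums x c (by rw [hq, hs, hc])) hyc (hs.trans hsy.symm)
  interval_cases n
  · exact ⟨1, by
      rw [key 0 ![1, 1, 0, 0, 0, 0, 0, 0] (by decide) (by unfold Antitone; decide)
        (by decide) (by decide)]
      decide⟩
  · exact ⟨2, by
      rw [key 0 ![1, 1, 1, 1, 1, 0, 0, 0] (by decide) (by unfold Antitone; decide)
        (by decide) (by decide)]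
      decide⟩
  · exact ⟨3, by rw [antitone_of_degree_three hx hq hs]; decide⟩
  · exact ⟨4, by
      rw [key 1 ![2, 2, 2, 1, 1, 1, 1, 1] (by decide) (by unfold Antitone; decide)
        (by decide) (by decide)]
      decide⟩
  · exact ⟨5, by
      rw [key 1 ![2, 2, 2, 2, 2, 2, 1, 1] (by decide) (by unfold Antitone; decide)
        (by decide) (by decide)]
      decide⟩
  · exact ⟨6, by
      rw [key 2 ![3, 2, 2, 2, 2, 2, 2, 2] (by decide) (by unfold Antitone; decide)
        (by decide) (by decide)]
      decide⟩

theorem monotone_of_degree_zero {x : Fin 8 → ℤ} (hx : Monotone x)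
    (hq : ∑ i, x i ^ 2 = 1) (hs : ∑ i, x i = -1) :
    x = ![-1, 0, 0, 0, 0, 0, 0, 0] := by
  have h : -x = ![1, 0, 0, 0, 0, 0, 0, 0] :=
    antitone_eq_of_consecutive (c := 0) hx.neg (by unfold Antitone; decide)
      (mem_consecutive_of_sums _ 0 (by simp [hq, hs])) (by decide) (by simp [hs]; decide)
  rw [← neg_neg x, h]
  decide

/-- A vector `d ∈ Λ` is exceptional if and only if there is a permutation `π` of `{1,…,8}`
such that `(d₀, −d_{π(1)}, …, −d_{π(8)})` is one of the seven vectors of the table. -/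
theorem stmt_0 (d : Fin 9 → ℤ) :
    IsExceptional d ↔ ∃ (π : Equiv.Perm (Fin 8)) (j : Fin 7),
      (Fin.cons (d 0) (fun i : Fin 8 => -d ((π i).succ)) : Fin 9 → ℤ) = excVectors j := by
  rw [isExceptional_iff_sums]
  set x : Fin 8 → ℤ := fun i => -d i.succ
  constructor
  · rintro ⟨hq, hs⟩
    have hq' : ∀ π : Equiv.Perm (Fin 8), ∑ i, (x ∘ π) i ^ 2 = d 0 ^ 2 + 1 := fun π =>
      (Equiv.sum_comp π fun i => x i ^ 2).trans hq
    have hs' : ∀ π : Equiv.Perm (Fin 8), ∑ i, (x ∘ π) i = 3 * d 0 - 1 := fun π =>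
      (Equiv.sum_comp π x).trans hs
    rcases (degree_mem_Icc hq hs).1.eq_or_lt with h | h
    · obtain ⟨π, hπ⟩ := exists_perm_monotone_comp x
      have hxπ := monotone_of_degree_zero hπ (by rw [hq' π, ← h]; rfl) (by rw [hs' π, ← h]; rfl)
      refine ⟨π, 0, ?_⟩
      change (Fin.cons (d 0) (x ∘ π) : Fin 9 → ℤ) = _
      rw [hxπ, ← h]
      decide
    · obtain ⟨π, hπ⟩ := exists_perm_antitone_comp x
      exact ⟨π, antitone_cases hπ (hq' π) (hs' π) h⟩
  · rintro ⟨π, j, h⟩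
    have h₀ : d 0 = excVectors j 0 := congrFun h 0
    have h₁ : ∀ i, x (π i) = excVectors j i.succ := fun i => congrFun h i.succ
    change ∑ i, x i ^ 2 = _ ∧ ∑ i, x i = _
    rw [← Equiv.sum_comp π fun i => x i ^ 2, ← Equiv.sum_comp π x]
    simp only [h₀, h₁]
    clear h h₀ h₁
    revert j
    decide
end

section
/- The set C of exceptional vectors in Λ has exactly 240 elements. -/
/-- Fibering a set of integer vectors over the first coordinate. -/
theorem encard_eq_sum_of_cons {n : ℕ} (P : ℤ → (Fin n → ℤ) → Prop) (I : Finset ℤ)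
    (hI : ∀ v x, P v x → v ∈ I) :
    {d : Fin (n + 1) → ℤ | P (d 0) fun i ↦ d i.succ}.encard = ∑ v ∈ I, {x | P v x}.encard := by
  have hunion : {d : Fin (n + 1) → ℤ | P (d 0) fun i ↦ d i.succ} =
      ⋃ v ∈ I, (Fin.cons (α := fun _ ↦ ℤ) v) '' {x | P v x} := by
    ext d
    simp only [Set.mem_ofPred_eq, Set.mem_iUnion, Set.mem_image, exists_prop]
    constructor
    · intro h
      exact ⟨d 0, hI _ _ h, _, h, Fin.cons_self_tail d⟩
    · rintro ⟨v, -, x, hx, rfl⟩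
      simpa using hx
  have hdisj : (I : Set ℤ).PairwiseDisjoint
      fun v ↦ (Fin.cons (α := fun _ ↦ ℤ) v) '' {x | P v x} := by
    intro v _ w _ hvw
    refine Set.disjoint_left.2 ?_
    rintro _ ⟨x, -, rfl⟩ ⟨y, -, hy⟩
    exact hvw (Fin.cons_injective2 hy).1.symm
  have h := I.finite_toSet.encard_biUnion hdisj
  rw [finsum_mem_coe_finset] at h
  refine hunion ▸ h.trans ?_
  exact Finset.sum_congr rfl fun v _ ↦
    (Fin.cons_right_injective (α := fun _ ↦ ℤ) v).encard_image _

/-- The number of `x ∈ ℤⁿ` with `∑ xᵢ = s` and `∑ xᵢ² = q`, provided `q < 64`. Branches violating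
the Cauchy–Schwarz inequality are pruned. -/
noncomputable def sumSqCount : ℕ → ℤ → ℤ → ℕ
  | 0, s, q => if s = 0 ∧ q = 0 then 1 else 0
  | n + 1, s, q =>
    if s ^ 2 ≤ (n + 1) * q then
      ∑ v ∈ Finset.Icc (-7) 7, sumSqCount n (s - v) (q - v ^ 2)
    else 0

theorem encard_sum_sq (n : ℕ) (s q : ℤ) (hq : q < 64) :
    {x : Fin n → ℤ | ∑ i, x i = s ∧ ∑ i, x i ^ 2 = q}.encard = sumSqCount n s q := by
  induction n generalizing s q with
  | zero =>
    by_cases h : s = 0 ∧ q = 0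
    · obtain ⟨rfl, rfl⟩ := h
      simp [sumSqCount]
    · have h' : ¬(0 = s ∧ 0 = q) := fun h' ↦ h ⟨h'.1.symm, h'.2.symm⟩
      simp [sumSqCount, h, h']
  | succ n ih =>
    rw [sumSqCount]
    split_ifs with h
    · have hset : {x : Fin (n + 1) → ℤ | ∑ i, x i = s ∧ ∑ i, x i ^ 2 = q} =
          {x | ∑ i : Fin n, x i.succ = s - x 0 ∧ ∑ i : Fin n, x i.succ ^ 2 = q - x 0 ^ 2} := by
        ext x
        simp only [Set.mem_ofPred_eq, Fin.sum_univ_succ, eq_sub_iff_add_eq']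
      rw [hset, encard_eq_sum_of_cons
        (fun v x ↦ ∑ i, x i = s - v ∧ ∑ i, x i ^ 2 = q - v ^ 2) (Finset.Icc (-7) 7)]
      · push_cast
        exact Finset.sum_congr rfl fun v _ ↦ ih _ _ (by nlinarith [sq_nonneg v])
      · rintro v x ⟨-, hx⟩
        have : 0 ≤ ∑ i, x i ^ 2 := Finset.sum_nonneg fun i _ ↦ sq_nonneg _
        rw [Finset.mem_Icc]
        constructor <;> nlinarith
    · rw [Nat.cast_zero, Set.encard_eq_zero, Set.eq_empty_iff_forall_notMem]
      rintro x ⟨rfl, rfl⟩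
      refine h ?_
      simpa using sq_sum_le_card_mul_sum_sq (s := Finset.univ) (f := x)

theorem isExceptional_iff (d : Fin 9 → ℤ) :
    IsExceptional d ↔
      ∑ i : Fin 8, d i.succ = 1 - 3 * d 0 ∧ ∑ i : Fin 8, d i.succ ^ 2 = d 0 ^ 2 + 1 := by
  simp only [IsExceptional, dot, KK, Fin.sum_univ_succ]
  simp
  constructor <;> rintro ⟨h₁, h₂⟩ <;> constructor <;> linarith

/-- The degree of an exceptional vector is bounded, by the Cauchy–Schwarz inequality. -/
theorem mem_Icc_of_sum_eq {a : ℤ} {x : Fin 8 → ℤ}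
    (h : ∑ i, x i = 1 - 3 * a ∧ ∑ i, x i ^ 2 = a ^ 2 + 1) : a ∈ Finset.Icc (-1) 7 := by
  have hcs := sq_sum_le_card_mul_sum_sq (s := Finset.univ) (f := x)
  rw [h.1, h.2, Finset.card_univ, Fintype.card_fin] at hcs
  push_cast at hcs
  rw [Finset.mem_Icc]
  constructor <;> nlinarith

/-- The set of exceptional vectors has exactly 240 elements. -/
theorem stmt_1 : {d : Fin 9 → ℤ | IsExceptional d}.ncard = 240 := by
  have hcard : {d : Fin 9 → ℤ | IsExceptional d}.encard =
      ∑ a ∈ Finset.Icc (-1 : ℤ) 7, (sumSqCount 8 (1 - 3 * a) (a ^ 2 + 1) : ℕ∞) := by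
    simp only [isExceptional_iff]
    rw [encard_eq_sum_of_cons (fun a x ↦ ∑ i, x i = 1 - 3 * a ∧ ∑ i, x i ^ 2 = a ^ 2 + 1)
      (Finset.Icc (-1) 7) fun _ _ ↦ mem_Icc_of_sum_eq]
    refine Finset.sum_congr rfl fun a ha ↦ encard_sum_sq _ _ _ ?_
    rw [Finset.mem_Icc] at ha
    nlinarith
  have hcount : ∑ a ∈ Finset.Icc (-1 : ℤ) 7, sumSqCount 8 (1 - 3 * a) (a ^ 2 + 1) = 240 := by
    decide +kernel
  rw [Set.ncard, hcard, ← Nat.cast_sum, hcount]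
  rfl
end

section
/- The map c ↦ c + K is a bijection from the set C of exceptional vectors onto the set E = { r ∈ Λ : r·r = −2 and r·K = 0 }, and for all c₁, c₂ ∈ C one has (c₁ + K)·(c₂ + K) = c₁·c₂ − 1. -/
theorem dot_comm (d e : Fin 9 → ℤ) : dot d e = dot e d := by
  simp only [dot, mul_comm]

theorem dot_add_left (a b e : Fin 9 → ℤ) : dot (a + b) e = dot a e + dot b e := by
  simp only [dot, Pi.add_apply, add_mul, Finset.sum_add_distrib]
  ring

theorem dot_add_right (d a b : Fin 9 → ℤ) : dot d (a + b) = dot d a + dot d b := by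
  rw [dot_comm, dot_add_left, dot_comm a, dot_comm b]

theorem dot_KK_KK : dot KK KK = 1 := by decide

theorem dot_add_KK_add_KK (a b : Fin 9 → ℤ) :
    dot (a + KK) (b + KK) = dot a b + dot a KK + dot b KK + 1 := by
  rw [dot_add_left, dot_add_right, dot_add_right, dot_KK_KK, dot_comm KK b]
  ring

theorem dot_add_KK_KK (a : Fin 9 → ℤ) : dot (a + KK) KK = dot a KK + 1 := by
  rw [dot_add_left, dot_KK_KK]

theorem isExceptional_iff_add_KK (c : Fin 9 → ℤ) :
    IsExceptional c ↔ dot (c + KK) (c + KK) = -2 ∧ dot (c + KK) KK = 0 := by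
  rw [IsExceptional, dot_add_KK_add_KK, dot_add_KK_KK]
  omega

/-- The map `c ↦ c + K` is a bijection from the set of exceptional vectors onto the set
`E = { r : r·r = −2, r·K = 0 }`, and for exceptional `c₁, c₂` one has
`(c₁ + K)·(c₂ + K) = c₁·c₂ − 1`. -/
theorem stmt_2 :
    Set.BijOn (fun c => c + KK) {d : Fin 9 → ℤ | IsExceptional d}
      {r : Fin 9 → ℤ | dot r r = -2 ∧ dot r KK = 0} ∧
    ∀ c₁ c₂ : Fin 9 → ℤ, IsExceptional c₁ → IsExceptional c₂ →
      dot (c₁ + KK) (c₂ + KK) = dot c₁ c₂ - 1 := by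
  refine ⟨⟨fun c hc => (isExceptional_iff_add_KK c).1 hc, (add_left_injective KK).injOn,
    fun r hr => ⟨r - KK, ?_, sub_add_cancel r KK⟩⟩, fun c₁ c₂ h₁ h₂ => ?_⟩
  · refine (isExceptional_iff_add_KK _).2 ?_
    rwa [sub_add_cancel]
  · rw [dot_add_KK_add_KK, h₁.2, h₂.2]
    ring
end

section
/- Every subset S of the set C of exceptional vectors such that d·e > 0 for all distinct d, e ∈ S has cardinality at most 16. -/
open scoped InnerProductSpace in
/-- A finite family of nonzero vectors with pairwise nonpositive inner products in a real inner
product space of dimension `n` has at most `2 * n` members. -/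
theorem card_le_two_mul_of_inner_nonpos {ι : Type*} (n : ℕ) :
    ∀ {E : Type*} [NormedAddCommGroup E] [InnerProductSpace ℝ E] [FiniteDimensional ℝ E],
      Module.finrank ℝ E = n → ∀ (s : Finset ι) (f : ι → E), (∀ i ∈ s, f i ≠ 0) →
      (∀ i ∈ s, ∀ j ∈ s, i ≠ j → ⟪f i, f j⟫_ℝ ≤ 0) → s.card ≤ 2 * n := by
  classical
  induction n with
  | zero =>
    intro E _ _ _ hE s f hne _
    have := Module.finrank_zero_iff.mp hE
    have hs : s = ∅ := Finset.eq_empty_of_forall_notMem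
      fun i hi => hne i hi (Subsingleton.elim _ _)
    simp [hs]
  | succ n ih =>
    intro E _ _ _ hE s f hne hneg
    obtain rfl | ⟨k, hk⟩ := s.eq_empty_or_nonempty
    · simp
    have : Fact (Module.finrank ℝ E = n + 1) := ⟨hE⟩
    set v := f k
    have hv : 0 < ⟪v, v⟫_ℝ := real_inner_self_pos.mpr (hne k hk)
    have hmem (x : E) : x - (⟪v, x⟫_ℝ / ⟪v, v⟫_ℝ) • v ∈ (ℝ ∙ v)ᗮ := by
      rw [Submodule.mem_orthogonal_singleton_iff_inner_right, inner_sub_right, inner_smul_right,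
        div_mul_cancel₀ _ hv.ne', sub_self]
    let g : ι → (ℝ ∙ v)ᗮ := fun i => ⟨_, hmem (f i)⟩
    have hg (i j : ι) :
        ⟪g i, g j⟫_ℝ = ⟪f i, f j⟫_ℝ - ⟪v, f i⟫_ℝ * ⟪v, f j⟫_ℝ / ⟪v, v⟫_ℝ := by
      simp only [g, Submodule.coe_inner, inner_sub_left, inner_sub_right, inner_smul_left,
        inner_smul_right, RCLike.conj_to_real, real_inner_comm v (f i)]
      field_simp
      ring
    have hzero : ((s.erase k).filter (g · = 0)).card ≤ 1 := by
      refine Finset.card_le_one.mpr fun i hi j hj => ?_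
      simp only [Finset.mem_filter, Finset.mem_erase] at hi hj
      obtain ⟨⟨hik, his⟩, hi0⟩ := hi
      obtain ⟨⟨hjk, hjs⟩, hj0⟩ := hj
      by_contra hij
      have neg {i : ι} (hik : i ≠ k) (his : i ∈ s) (hi0 : g i = 0) : ⟪v, f i⟫_ℝ < 0 := by
        refine (hneg k hk i his hik.symm).lt_of_ne fun h => hne i his ?_
        simpa [g, Subtype.ext_iff, show ⟪v, f i⟫_ℝ = 0 from h] using hi0
      have h := hg i j
      rw [hi0, inner_zero_left] at h
      have := div_pos (mul_pos_of_neg_of_neg (neg hik his hi0) (neg hjk hjs hj0)) hv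
      linarith [hneg i his j hjs hij]
    have hrest : ((s.erase k).filter (¬ g · = 0)).card ≤ 2 * n := by
      refine ih (Submodule.finrank_orthogonal_span_singleton (hne k hk)) _ g
        (fun i hi => (Finset.mem_filter.mp hi).2) fun i hi j hj hij => ?_
      simp only [Finset.mem_filter, Finset.mem_erase] at hi hj
      have := div_nonneg (mul_nonneg_of_nonpos_of_nonpos (hneg k hk i hi.1.2 hi.1.1.symm)
        (hneg k hk j hj.1.2 hj.1.1.symm)) hv.le
      linarith [hg i j, hneg i hi.1.2 j hj.1.2 hij]
    have := Finset.card_filter_add_card_filter_not (s := s.erase k) (g · = 0)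
    have := Finset.card_erase_add_one hk
    lia

/-- Twice the image of `d + K` under an isometry from `Kᗮ`, with the form negated, onto Euclidean
space. -/
def exceptionalToEuclidean (d : Fin 9 → ℤ) : EuclideanSpace ℝ (Fin 8) :=
  WithLp.toLp 2 fun i => ((2 * d i.succ + d 0 - 1 : ℤ) : ℝ)

theorem inner_exceptionalToEuclidean {d e : Fin 9 → ℤ} (hd : dot d KK = -1) (he : dot e KK = -1) :
    inner ℝ (exceptionalToEuclidean d) (exceptionalToEuclidean e) = ((4 * (1 - dot d e) : ℤ) : ℝ) := by
  have key : ∑ i : Fin 8, (2 * e i.succ + e 0 - 1) * (2 * d i.succ + d 0 - 1)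
      = 4 * (1 - dot d e) := by
    simp [dot, KK, Fin.sum_univ_succ] at hd he ⊢
    linear_combination (-2 * (e 0 - 1)) * hd + (-2 * (d 0 - 1)) * he
  rw [← key]
  simp [exceptionalToEuclidean, PiLp.inner_apply]

/-- Every set of exceptional vectors with pairwise positive products has at most 16 elements. -/
theorem stmt_7 (S : Finset (Fin 9 → ℤ)) (hexc : ∀ d ∈ S, IsExceptional d)
    (hpos : ∀ d ∈ S, ∀ e ∈ S, d ≠ e → 0 < dot d e) :
    S.card ≤ 16 := by
  refine card_le_two_mul_of_inner_nonpos 8 (finrank_euclideanSpace_fin (𝕜 := ℝ)) S exceptionalToEuclidean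
    (fun d hd h0 => ?_) fun d hd e he hde => ?_
  · have h := inner_exceptionalToEuclidean (hexc d hd).2 (hexc d hd).2
    rw [h0, inner_zero_left, (hexc d hd).1] at h
    norm_num at h
  · rw [inner_exceptionalToEuclidean (hexc d hd).2 (hexc e he).2]
    have := hpos d hd e he hde
    exact_mod_cast (by lia : 4 * (1 - dot d e) ≤ 0)
end

section
/- Every subset S of the set C of exceptional vectors such that d·e ∈ {1, 2} for all distinct d, e ∈ S has cardinality at most 12, and there exists such a subset S of cardinality exactly 12. -/
open Finset Module Submodule in
/-- A linearly dependent finite set of vectors with pairwise nonpositive inner products carries a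
linear relation with positive coefficients. -/
theorem exists_pos_relation_of_inner_nonpos {V : Type*} [NormedAddCommGroup V]
    [InnerProductSpace ℝ V] {S : Finset V}
    (hS : ∀ u ∈ S, ∀ v ∈ S, u ≠ v → inner ℝ u v ≤ 0)
    (hdep : ¬ LinearIndepOn ℝ id (S : Set V)) :
    ∃ T ⊆ S, T.Nonempty ∧ ∃ c : V → ℝ, (∀ t ∈ T, 0 < c t) ∧ ∑ t ∈ T, c t • t = 0 := by
  classical
  obtain ⟨c, hsum, i, hi, hci⟩ :
      ∃ c : V → ℝ, ∑ t ∈ S, c t • t = 0 ∧ ∃ i ∈ S, 0 < c i := by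
    rw [linearIndepOn_finset_iff] at hdep
    push Not at hdep
    obtain ⟨c, hsum, i, hi, hci⟩ := hdep
    rcases hci.lt_or_gt with h | h
    · exact ⟨-c, by simpa using hsum, i, hi, by simpa using h⟩
    · exact ⟨c, by simpa using hsum, i, hi, h⟩
  refine ⟨S.filter (0 < c ·), filter_subset _ _, ⟨i, by simp [hi, hci]⟩, c,
    fun t ht ↦ (mem_filter.1 ht).2, ?_⟩
  have hsplit : ∑ t ∈ S with 0 < c t, c t • t = ∑ t ∈ S with ¬ 0 < c t, (-c t) • t := by
    rw [← sum_filter_add_sum_filter_not S (0 < c ·)] at hsum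
    simp_rw [neg_smul, sum_neg_distrib]
    exact eq_neg_of_add_eq_zero_left hsum
  rw [← real_inner_self_nonpos]
  nth_rw 2 [hsplit]
  simp_rw [sum_inner, inner_sum, inner_smul_left, inner_smul_right]
  refine sum_nonpos fun t ht ↦ sum_nonpos fun u hu ↦ ?_
  rw [mem_filter] at ht hu
  have htu : t ≠ u := by rintro rfl; exact hu.2 ht.2
  exact mul_nonpos_of_nonneg_of_nonpos ht.2.le
    (mul_nonpos_of_nonneg_of_nonpos (by linarith [hu.2]) (hS t ht.1 u hu.1 htu))

open Finset Module Submodule in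
/-- Nonzero vectors with pairwise nonpositive inner products, none of which is a negative multiple
of another, number at most `3 / 2` times the dimension of their span. -/
theorem two_mul_card_le_three_mul_finrank_span {V : Type*} [NormedAddCommGroup V]
    [InnerProductSpace ℝ V] (S : Finset V)
    (hS : ∀ u ∈ S, ∀ v ∈ S, u ≠ v → inner ℝ u v ≤ 0)
    (hpos : ∀ u ∈ S, ∀ v ∈ S, ∀ a b : ℝ, 0 < a → 0 < b → a • u + b • v ≠ 0) :
    2 * #S ≤ 3 * finrank ℝ (span ℝ (S : Set V)) := by
  classical
  induction S using Finset.strongInduction with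
  | H S ih =>
  by_cases hind : LinearIndepOn ℝ id (S : Set V)
  · rw [finrank_span_finset_eq_card hind]
    lia
  obtain ⟨T₀, hT₀S, hT₀⟩ := exists_pos_relation_of_inner_nonpos hS hind
  obtain ⟨T, hTT₀, ⟨hTne, c, hc, hsum⟩, hTmin⟩ := exists_minimal_le_of_wellFoundedLT
    (fun T : Finset V ↦ T.Nonempty ∧ ∃ c : V → ℝ, (∀ t ∈ T, 0 < c t) ∧ ∑ t ∈ T, c t • t = 0)
    T₀ hT₀
  have hTS : T ⊆ S := hTT₀.trans hT₀S
  have hcard : 3 ≤ #T := by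
    by_contra! h
    have h0 := hTne.card_pos
    obtain h1 | h2 : #T = 1 ∨ #T = 2 := by lia
    · obtain ⟨u, rfl⟩ := card_eq_one.1 h1
      have hu := hc u (by simp)
      refine hpos u (hTS (by simp)) u (hTS (by simp)) _ _ hu hu ?_
      rw [sum_singleton] at hsum
      rw [hsum, add_zero]
    · obtain ⟨u, v, huv, rfl⟩ := card_eq_two.1 h2
      refine hpos u (hTS (by simp)) v (hTS (by simp)) _ _ (hc u (by simp)) (hc v (by simp)) ?_
      rwa [sum_pair huv] at hsum
  have hrank : #T - 1 ≤ finrank ℝ (span ℝ (T : Set V)) := by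
    obtain ⟨v, hv⟩ := hTne
    have hlin : LinearIndepOn ℝ id (T.erase v : Set V) := by
      by_contra hdep
      obtain ⟨T', hT', hT'rel⟩ := exists_pos_relation_of_inner_nonpos
        (fun u hu w hw ↦ hS u (hTS (erase_subset _ _ hu)) w (hTS (erase_subset _ _ hw))) hdep
      exact notMem_erase v T (hT' (hTmin hT'rel (hT'.trans (erase_subset _ _)) hv))
    rw [← card_erase_of_mem hv, ← finrank_span_finset_eq_card hlin]
    exact finrank_mono (span_mono (by simp))
  have horth : span ℝ (T : Set V) ⟂ span ℝ ((S \ T : Finset V) : Set V) := by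
    rw [isOrtho_span]
    intro t ht v hv
    rw [mem_coe] at ht hv
    rw [mem_sdiff] at hv
    have hle : ∀ u ∈ T, c u * inner ℝ u v ≤ 0 := fun u hu ↦
      mul_nonpos_of_nonneg_of_nonpos (hc u hu).le
        (hS u (hTS hu) v hv.1 (by rintro rfl; exact hv.2 hu))
    have hzero : ∑ u ∈ T, c u * inner ℝ u v = 0 := by
      simpa [sum_inner, inner_smul_left] using congrArg (inner ℝ · v) hsum
    exact (mul_eq_zero.1 ((sum_eq_zero_iff_of_nonpos hle).1 hzero t ht)).resolve_left (hc t ht).ne'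
  have hdim := finrank_sup_add_finrank_inf_eq (span ℝ (T : Set V))
    (span ℝ ((S \ T : Finset V) : Set V))
  rw [horth.disjoint.eq_bot, finrank_bot, ← span_union, ← coe_union, union_sdiff_of_subset hTS]
    at hdim
  have hrest := ih (S \ T) (sdiff_ssubset hTS hTne)
    (fun u hu v hv ↦ hS u (mem_sdiff.1 hu).1 v (mem_sdiff.1 hv).1)
    (fun u hu v hv ↦ hpos u (mem_sdiff.1 hu).1 v (mem_sdiff.1 hv).1)
  have := card_sdiff_add_card_eq_card hTS
  lia

/-- The map `d ↦ d + K`, followed by an isometry of `K^⊥` with the negated form into Euclidean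
`8`-space; it sends exceptional vectors to the roots of `E₈`. -/
noncomputable def toRoot (d : Fin 9 → ℤ) : EuclideanSpace ℝ (Fin 8) :=
  WithLp.toLp 2 fun i ↦ (d i.succ + 1 : ℝ) + (d 0 - 3 : ℝ) / 4

theorem inner_toRoot {d e : Fin 9 → ℤ} (hd : IsExceptional d) (he : IsExceptional e) :
    inner ℝ (toRoot d) (toRoot e) = 1 - (dot d e : ℝ) := by
  have hd' : (dot d KK : ℝ) = -1 := by exact_mod_cast hd.2
  have he' : (dot e KK : ℝ) = -1 := by exact_mod_cast he.2
  simp [dot, KK, Fin.sum_univ_succ] at hd' he'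
  simp [toRoot, dot, PiLp.inner_apply, Fin.sum_univ_succ]
  linear_combination -(e 0 + 1 : ℝ) / 4 * hd' - (d 0 + 1 : ℝ) / 4 * he'

/-- Twelve exceptional vectors whose images under `toRoot` form four mutually orthogonal
extended `A₂` systems. -/
def twelveExceptional : Finset (Fin 9 → ℤ) :=
  {![0, 1, 0, 0, 0, 0, 0, 0, 0],
   ![3, -2, 0, -1, -1, -1, -1, -1, -1],
   ![6, -2, -3, -2, -2, -2, -2, -2, -2],
   ![1, -1, -1, 0, 0, 0, 0, 0, 0],
   ![4, -1, -1, -1, -1, -1, -2, -2, -2],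
   ![4, -1, -1, -2, -2, -2, -1, -1, -1],
   ![3, -1, -1, 0, -1, -2, -1, -1, -1],
   ![3, -1, -1, -1, -2, 0, -1, -1, -1],
   ![3, -1, -1, -2, 0, -1, -1, -1, -1],
   ![3, -1, -1, -1, -1, -1, 0, -1, -2],
   ![3, -1, -1, -1, -1, -1, -1, -2, 0],
   ![3, -1, -1, -1, -1, -1, -2, 0, -1]}

/-- Every set of exceptional vectors with pairwise products in {1, 2} has at most 12 elements,
and there is such a set with exactly 12 elements. -/
theorem stmt_8 :
    (∀ S : Finset (Fin 9 → ℤ), (∀ d ∈ S, IsExceptional d) →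
      (∀ d ∈ S, ∀ e ∈ S, d ≠ e → dot d e = 1 ∨ dot d e = 2) → S.card ≤ 12) ∧
    (∃ S : Finset (Fin 9 → ℤ), (∀ d ∈ S, IsExceptional d) ∧
      (∀ d ∈ S, ∀ e ∈ S, d ≠ e → dot d e = 1 ∨ dot d e = 2) ∧ S.card = 12) := by
  classical
  refine ⟨fun S hS hdot ↦ ?_, twelveExceptional, ?_, ?_, by decide⟩
  · have hself : ∀ d ∈ S, inner ℝ (toRoot d) (toRoot d) = (2 : ℝ) := fun d hd ↦ by
      rw [inner_toRoot (hS d hd) (hS d hd), (hS d hd).1]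
      norm_num
    have hne : ∀ d ∈ S, ∀ e ∈ S, d ≠ e → -1 ≤ inner ℝ (toRoot d) (toRoot e) ∧
        inner ℝ (toRoot d) (toRoot e) ≤ 0 := fun d hd e he hde ↦ by
      rw [inner_toRoot (hS d hd) (hS e he)]
      rcases hdot d hd e he hde with h | h <;> norm_num [h]
    have hinj : Set.InjOn toRoot (S : Set (Fin 9 → ℤ)) := fun d hd e he hde ↦ by
      by_contra h
      have := (hne d hd e he h).2
      rw [← hde, hself d hd] at this
      norm_num at this
    have hbound := two_mul_card_le_three_mul_finrank_span (S.image toRoot) ?_ ?_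
    · rw [Finset.card_image_of_injOn hinj] at hbound
      have := Submodule.finrank_le
        (Submodule.span ℝ (S.image toRoot : Set (EuclideanSpace ℝ (Fin 8))))
      rw [finrank_euclideanSpace_fin] at this
      lia
    · simp only [Finset.forall_mem_image]
      exact fun d hd e he hde ↦ (hne d hd e he (fun h ↦ hde (h ▸ rfl))).2
    · simp only [Finset.forall_mem_image]
      intro d hd e he a b ha hb hab
      have hge : -1 ≤ inner ℝ (toRoot d) (toRoot e) := by
        by_cases hde : d = e
        · rw [← hde, hself d hd]
          norm_num
        · exact (hne d hd e he hde).1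
      have h := congrArg (inner ℝ (toRoot d + toRoot e)) hab
      simp only [inner_add_left, inner_add_right, inner_smul_right, inner_zero_right, hself d hd,
        hself e he, real_inner_comm (toRoot d) (toRoot e)] at h
      nlinarith [mul_nonneg (add_pos ha hb).le (neg_le_iff_add_nonneg.1 hge)]
  · unfold IsExceptional
    decide
  · decide
end

section
/- Let n ∈ {2, 3, 5, 6, 7, 8}. Suppose e₁, …, eₙ, c₁, …, cₙ ∈ C satisfy eᵢ·cᵢ = 3 for all i, and eᵢ·eⱼ = eᵢ·cⱼ = cᵢ·cⱼ = 1 for all i ≠ j; suppose f₁, …, fₙ, d₁, …, dₙ ∈ C satisfy the same conditions. Then there exists σ ∈ W mapping the set {e₁, …, eₙ, c₁, …, cₙ} onto the set {f₁, …, fₙ, d₁, …, dₙ}. -/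
/-- The set `C` of exceptional vectors. -/
def Cset : Set (Fin 9 → ℤ) := {d | IsExceptional d}

/-- `σ` belongs to the group `W` of permutations of `C` preserving the pairing. -/
def MemW (σ : (Fin 9 → ℤ) → (Fin 9 → ℤ)) : Prop :=
  Set.BijOn σ Cset Cset ∧ ∀ d ∈ Cset, ∀ e ∈ Cset, dot (σ d) (σ e) = dot d e

/-! ### The form, and the partner of an exceptional vector -/

theorem dot_comm_s10 (x y : Fin 9 → ℤ) : dot x y = dot y x := by
  simp only [dot, mul_comm]

theorem dot_add_left_s10 (x y z : Fin 9 → ℤ) : dot (x + y) z = dot x z + dot y z := by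
  simp only [dot, Pi.add_apply, add_mul, Finset.sum_add_distrib]; ring

theorem dot_smul_left (a : ℤ) (x y : Fin 9 → ℤ) : dot (a • x) y = a * dot x y := by
  simp only [dot, Pi.smul_apply, smul_eq_mul, mul_assoc, ← Finset.mul_sum]; ring

theorem dot_sub_left (x y z : Fin 9 → ℤ) : dot (x - y) z = dot x z - dot y z := by
  simp only [dot, Pi.sub_apply, sub_mul, Finset.sum_sub_distrib]; ring

theorem dot_add_right_s10 (x y z : Fin 9 → ℤ) : dot x (y + z) = dot x y + dot x z := by
  rw [dot_comm_s10, dot_add_left_s10, dot_comm_s10 y, dot_comm_s10 z]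

theorem dot_smul_right (a : ℤ) (x y : Fin 9 → ℤ) : dot x (a • y) = a * dot x y := by
  rw [dot_comm_s10, dot_smul_left, dot_comm_s10 y]

theorem dot_sub_right (x y z : Fin 9 → ℤ) : dot x (y - z) = dot x y - dot x z := by
  rw [dot_comm_s10, dot_sub_left, dot_comm_s10 y, dot_comm_s10 z]

theorem dot_KK_right (x : Fin 9 → ℤ) : dot x KK = -3 * x 0 - ∑ i : Fin 8, x i.succ := by
  have h : ∀ i : Fin 8, KK i.succ = 1 := by decide
  simp only [dot, h, mul_one, show KK 0 = -3 from rfl]; ring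

/-- The form is negative definite on the orthogonal complement of `K`. -/
theorem dot_self_nonpos {v : Fin 9 → ℤ} (hv : dot v KK = 0) :
    dot v v ≤ 0 ∧ (dot v v = 0 → v = 0) := by
  have hs : ∑ i : Fin 8, v i.succ = -3 * v 0 := by rw [dot_KK_right] at hv; linarith
  have hcs := sq_sum_le_card_mul_sum_sq (s := Finset.univ) (f := fun i : Fin 8 => v i.succ)
  have hd : dot v v = v 0 ^ 2 - ∑ i : Fin 8, v i.succ ^ 2 := by simp only [dot, sq]
  rw [hs] at hcs
  simp only [Finset.card_univ, Fintype.card_fin] at hcs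
  push_cast at hcs
  refine ⟨by nlinarith [sq_nonneg (v 0)], fun h0 => ?_⟩
  have hz : v 0 = 0 := by
    have : v 0 ^ 2 ≤ 0 := by nlinarith
    nlinarith [pow_eq_zero_iff (two_ne_zero) |>.1 (le_antisymm this (sq_nonneg _))]
  have hsum : ∑ i : Fin 8, v i.succ ^ 2 = 0 := by rw [hd, hz] at h0; linarith
  rw [Finset.sum_eq_zero_iff_of_nonneg fun i _ => sq_nonneg _] at hsum
  funext i
  refine Fin.cases hz (fun j => ?_) i
  exact pow_eq_zero_iff two_ne_zero |>.1 (hsum j (Finset.mem_univ j))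

/-- The unique exceptional vector meeting `x` three times. -/
def partner (x : Fin 9 → ℤ) : Fin 9 → ℤ := (-2 : ℤ) • KK - x

theorem partner_partner (x : Fin 9 → ℤ) : partner (partner x) = x := sub_sub_cancel _ _

namespace IsExceptional

variable {x y : Fin 9 → ℤ}

theorem partner_dot (hy : IsExceptional y) : dot y (partner x) = 2 - dot y x := by
  rw [partner, dot_sub_right, dot_smul_right, hy.2]; ring

theorem neg_one_le_dot (hx : IsExceptional x) (hy : IsExceptional y) :
    -1 ≤ dot x y ∧ (dot x y = -1 → x = y) := by
  have h := dot_self_nonpos (v := x - y) (by rw [dot_sub_left, hx.2, hy.2]; rfl)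
  have e : dot (x - y) (x - y) = -2 - 2 * dot x y := by
    rw [dot_sub_left, dot_sub_right, dot_sub_right, hx.1, hy.1, dot_comm_s10 y x]; ring
  rw [e] at h
  exact ⟨by linarith [h.1], fun h' => sub_eq_zero.1 (h.2 (by rw [h']; rfl))⟩

theorem partner (hx : IsExceptional x) : IsExceptional (partner x) := by
  have hK : dot KK x = -1 := by rw [dot_comm_s10, hx.2]
  constructor <;> simp only [_root_.partner, dot_sub_left, dot_sub_right, dot_smul_left,
    dot_smul_right, hx.1, hx.2, dot_KK_KK, hK] <;> norm_num

theorem dot_le_three (hx : IsExceptional x) (hy : IsExceptional y) :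
    dot x y ≤ 3 ∧ (dot x y = 3 → x = _root_.partner y) := by
  have h := neg_one_le_dot hx hy.partner
  rw [hx.partner_dot] at h
  exact ⟨by linarith [h.1], fun h' => h.2 (by rw [h']; rfl)⟩

end IsExceptional

/-! ### Isometries -/

/-- The linear isometries fixing `K` and every vector of `P`. -/
def fixer (P : Set (Fin 9 → ℤ)) : Subgroup ((Fin 9 → ℤ) ≃ₗ[ℤ] (Fin 9 → ℤ)) where
  carrier := {g | (∀ x y, dot (g x) (g y) = dot x y) ∧ g KK = KK ∧ ∀ z ∈ P, g z = z}
  one_mem' := ⟨fun _ _ => rfl, rfl, fun _ _ => rfl⟩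
  mul_mem' := by
    rintro g h ⟨hg, hgK, hgP⟩ ⟨hh, hhK, hhP⟩
    refine ⟨fun x y => by simp [hg, hh], by simp [hgK, hhK], fun z hz => ?_⟩
    simp [hgP z hz, hhP z hz]
  inv_mem' := by
    rintro g ⟨hg, hgK, hgP⟩
    have key : ∀ z, g z = z → g⁻¹ z = z := fun z hz => g.symm_apply_eq.2 hz.symm
    refine ⟨fun x y => ?_, key _ hgK, fun z hz => key z (hgP z hz)⟩
    rw [← hg]
    exact congrArg₂ dot (g.apply_symm_apply x) (g.apply_symm_apply y)

theorem fixer_anti {P Q : Set (Fin 9 → ℤ)} (h : P ⊆ Q) : fixer Q ≤ fixer P :=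
  fun _ hg => ⟨hg.1, hg.2.1, fun z hz => hg.2.2 z (h hz)⟩

theorem IsExceptional.map {P : Set (Fin 9 → ℤ)} {g : (Fin 9 → ℤ) ≃ₗ[ℤ] (Fin 9 → ℤ)}
    (hg : g ∈ fixer P) {x : Fin 9 → ℤ} (hx : IsExceptional x) : IsExceptional (g x) := by
  refine ⟨by rw [hg.1, hx.1], ?_⟩
  rw [← hx.2, ← hg.1 x KK, hg.2.1]

theorem map_partner {P : Set (Fin 9 → ℤ)} {g : (Fin 9 → ℤ) ≃ₗ[ℤ] (Fin 9 → ℤ)}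
    (hg : g ∈ fixer P) (x : Fin 9 → ℤ) : g (partner x) = partner (g x) := by
  rw [partner, map_sub, map_smul, hg.2.1, partner]

theorem memW_of_mem_fixer {P : Set (Fin 9 → ℤ)} {g : (Fin 9 → ℤ) ≃ₗ[ℤ] (Fin 9 → ℤ)}
    (hg : g ∈ fixer P) : MemW g := by
  refine ⟨⟨fun x hx => IsExceptional.map hg hx, g.injective.injOn, fun y hy => ?_⟩,
    fun x _ y _ => hg.1 x y⟩
  exact ⟨g.symm y, IsExceptional.map (inv_mem hg) hy, g.apply_symm_apply y⟩

/-- The reflection in a vector `r` with `r·r = -2`. -/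
def reflect (r : Fin 9 → ℤ) (hr : dot r r = -2) : (Fin 9 → ℤ) ≃ₗ[ℤ] (Fin 9 → ℤ) :=
  LinearEquiv.ofInvolutive
    { toFun := fun x => x + dot x r • r
      map_add' := fun x y => by rw [dot_add_left_s10, add_smul]; abel
      map_smul' := fun a x => by rw [dot_smul_left, mul_smul, smul_add]; rfl }
    (fun x => by
      change x + dot x r • r + dot (x + dot x r • r) r • r = x
      rw [dot_add_left_s10, dot_smul_left, hr]
      module)

theorem reflect_apply (r : Fin 9 → ℤ) (hr : dot r r = -2) (x : Fin 9 → ℤ) :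
    reflect r hr x = x + dot x r • r := rfl

theorem reflect_mem_fixer {r : Fin 9 → ℤ} (hr : dot r r = -2) (hK : dot r KK = 0)
    {P : Set (Fin 9 → ℤ)} (hP : ∀ z ∈ P, dot z r = 0) : reflect r hr ∈ fixer P := by
  refine ⟨fun x y => ?_, ?_, fun z hz => ?_⟩
  · simp only [reflect_apply, dot_add_left_s10, dot_add_right_s10, dot_smul_left, dot_smul_right, hr,
      dot_comm_s10 r y]
    ring
  · rw [reflect_apply, dot_comm_s10, hK, zero_smul, add_zero]
  · rw [reflect_apply, hP z hz, zero_smul, add_zero]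

/-- The reflection attached to the exceptional vector `b`. -/
theorem exists_reflection {b : Fin 9 → ℤ} (hb : IsExceptional b) {P : Set (Fin 9 → ℤ)}
    (hP : ∀ z ∈ P, IsExceptional z ∧ dot z b = 1) :
    ∃ g ∈ fixer P, ∀ x, IsExceptional x → g x = x + (dot x b - 1) • (b + KK) := by
  have hK : dot KK b = -1 := by rw [dot_comm_s10, hb.2]
  refine ⟨reflect (b + KK) ?_, reflect_mem_fixer _ ?_ fun z hz => ?_, fun x hx => ?_⟩
  · rw [dot_add_left_s10, dot_add_right_s10, dot_add_right_s10, hb.1, hb.2, hK, dot_KK_KK]; rfl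
  · rw [dot_add_left_s10, hb.2, dot_KK_KK]; rfl
  · rw [dot_add_right_s10, (hP z hz).2, (hP z hz).1.2]; rfl
  · rw [reflect_apply, dot_add_right_s10, hx.2]; rfl

theorem exists_map_of_dot_eq_zero {x p : Fin 9 → ℤ} (hx : IsExceptional x)
    (hp : IsExceptional p) (h : dot x p = 0) {P : Set (Fin 9 → ℤ)}
    (hPx : ∀ z ∈ P, dot z x = 1) (hPp : ∀ z ∈ P, dot z p = 1) :
    ∃ g ∈ fixer P, g x = p := by
  refine ⟨reflect (x - p) ?_, reflect_mem_fixer _ ?_ fun z hz => ?_, ?_⟩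
  · rw [dot_sub_left, dot_sub_right, dot_sub_right, hx.1, hp.1, dot_comm_s10 p x, h]; rfl
  · rw [dot_sub_left, hx.2, hp.2]; rfl
  · rw [dot_sub_right, hPx z hz, hPp z hz]; rfl
  · rw [reflect_apply, dot_sub_right, hx.1, h]; module

theorem exists_swap_partner {p : Fin 9 → ℤ} (hp : IsExceptional p) {P : Set (Fin 9 → ℤ)}
    (hP : ∀ z ∈ P, IsExceptional z ∧ dot z p = 1) :
    ∃ g ∈ fixer P, g (partner p) = p ∧
      ∀ x, IsExceptional x → dot (g x) p = 2 - dot x p := by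
  obtain ⟨g, hg, hgx⟩ := exists_reflection hp hP
  refine ⟨g, hg, ?_, fun x hx => ?_⟩
  · rw [hgx _ hp.partner, dot_comm_s10, hp.partner_dot, hp.1, partner]; module
  · rw [hgx x hx, dot_add_left_s10, dot_smul_left, dot_add_left_s10, hp.1, dot_comm_s10 KK, hp.2]; ring

/-- If a vector `b` joins `x` to `p` whenever these are orthogonal, then some isometry fixing `P`
moves `x` to `p`. -/
theorem exists_map_eq {x p : Fin 9 → ℤ} (hx : IsExceptional x) (hp : IsExceptional p)
    {P : Set (Fin 9 → ℤ)} (hP : ∀ z ∈ P, IsExceptional z)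
    (hPx : ∀ z ∈ P, dot z x = 1) (hPp : ∀ z ∈ P, dot z p = 1)
    (hb : dot x p = 1 →
      ∃ b, IsExceptional b ∧ (∀ z ∈ P, dot z b = 1) ∧ dot x b = 0 ∧ dot b p = 2) :
    ∃ g ∈ fixer P, g x = p := by
  obtain ⟨h1, h1'⟩ := hx.neg_one_le_dot hp
  obtain ⟨h3, h3'⟩ := hx.dot_le_three hp
  have move : ∀ h ∈ fixer P, dot (h x) p = 0 → ∃ g ∈ fixer P, g x = p := fun h hh h0 => by
    obtain ⟨g, hg, hgx⟩ := exists_map_of_dot_eq_zero (hx.map hh) hp h0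
      (fun z hz => by rw [← hPx z hz, ← hh.1 z x, hh.2.2 z hz]) hPp
    exact ⟨g * h, mul_mem hg hh, hgx⟩
  obtain ⟨s, hs, hsp, hsx⟩ := exists_swap_partner hp fun z hz => ⟨hP z hz, hPp z hz⟩
  have hcases : dot x p = -1 ∨ dot x p = 0 ∨ dot x p = 1 ∨ dot x p = 2 ∨ dot x p = 3 := by lia
  rcases hcases with h | h | h | h | h
  · exact ⟨1, one_mem _, h1' h⟩
  · exact move 1 (one_mem _) h
  · obtain ⟨b, hb, hPb, hxb, hbp⟩ := hb h
    obtain ⟨g, hg, hgx⟩ := exists_reflection hb fun z hz => ⟨hP z hz, hPb z hz⟩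
    refine move g hg ?_
    rw [hgx x hx, dot_add_left_s10, dot_smul_left, dot_add_left_s10, h, hxb, hbp, dot_comm_s10 KK, hp.2]
    rfl
  · exact move s hs (by rw [hsx x hx, h]; rfl)
  · exact ⟨s, hs, by rw [h3' h, hsp]⟩

/-! ### Enumeration of the exceptional vectors -/

/-- The form on coordinate lists. -/
def listDot (l m : List ℤ) : ℤ :=
  match l, m with
  | a :: l, b :: m => a * b - (List.zipWith (· * ·) l m).foldr (· + ·) 0
  | _, _ => 0

theorem dot_eq_listDot (x y : Fin 9 → ℤ) : dot x y = listDot (List.ofFn x) (List.ofFn y) := by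
  simp [dot, listDot, List.ofFn_succ, Fin.sum_univ_succ]

/-- For each possible degree of an exceptional vector, the values its other coordinates take. -/
def degreeTable : List (ℤ × List ℤ) :=
  [(0, [0, 1]), (1, [-1, 0]), (2, [-1, 0]), (3, [-2, -1, 0]), (4, [-2, -1]), (5, [-2, -1]),
    (6, [-3, -2])]

/-- The lists of `n` entries from `vals` with sum `s` and sum of squares `q`; branches violating
the Cauchy–Schwarz inequality are pruned. -/
def listsWithSums (vals : List ℤ) : ℕ → ℤ → ℤ → List (List ℤ)
  | 0, s, q => if s = 0 ∧ q = 0 then [[]] else []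
  | n + 1, s, q =>
    if (n + 1 : ℕ) * q < s * s then []
    else vals.flatMap fun a => (listsWithSums vals n (s - a) (q - a * a)).map (a :: ·)

theorem ofFn_mem_listsWithSums {vals : List ℤ} {n : ℕ} (x : Fin n → ℤ) (hx : ∀ i, x i ∈ vals) :
    List.ofFn x ∈ listsWithSums vals n (∑ i, x i) (∑ i, x i * x i) := by
  induction n with
  | zero => simp [listsWithSums]
  | succ n ih =>
    have hcs := sq_sum_le_card_mul_sum_sq (s := Finset.univ) (f := x)
    simp only [Finset.card_univ, Fintype.card_fin, sq] at hcs
    rw [listsWithSums, if_neg (not_lt.2 hcs), List.ofFn_succ, Fin.sum_univ_succ,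
      Fin.sum_univ_succ]
    refine List.mem_flatMap.2 ⟨x 0, hx 0, List.mem_map.2 ⟨_, ?_, rfl⟩⟩
    rw [add_sub_cancel_left, add_sub_cancel_left]
    exact ih (fun i => x i.succ) fun i => hx i.succ

/-- The coordinate lists of the exceptional vectors. -/
def exceptionalList : List (List ℤ) :=
  degreeTable.flatMap fun t =>
    (listsWithSums t.2 8 (1 - 3 * t.1) (t.1 * t.1 + 1)).map (t.1 :: ·)

theorem sub_mul_sub_add_one_nonneg (b a : ℤ) : 0 ≤ (b - a) * (b - (a + 1)) := by
  rcases le_or_gt b a with h | h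
  · exact mul_nonneg_of_nonpos_of_nonpos (by linarith) (by linarith)
  · exact mul_nonneg (by linarith) (by linarith [Int.add_one_le_of_lt h])

theorem eq_or_eq_of_sum_eq_zero {x : Fin 8 → ℤ} {a : ℤ}
    (h : ∑ i, (x i - a) * (x i - (a + 1)) = 0) (i : Fin 8) : x i = a ∨ x i = a + 1 := by
  rw [Finset.sum_eq_zero_iff_of_nonneg fun j _ => sub_mul_sub_add_one_nonneg _ _] at h
  exact (mul_eq_zero.1 (h i (Finset.mem_univ i))).imp sub_eq_zero.1 sub_eq_zero.1

theorem IsExceptional.mem_degreeTable {x : Fin 9 → ℤ} (hx : IsExceptional x) :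
    ∃ t ∈ degreeTable, x 0 = t.1 ∧ ∀ i : Fin 8, x i.succ ∈ t.2 := by
  obtain ⟨h1, h2⟩ := hx
  rw [dot_KK_right] at h2
  have hs : ∑ i : Fin 8, x i.succ = 1 - 3 * x 0 := by linarith
  have hq : ∑ i : Fin 8, x i.succ * x i.succ = x 0 * x 0 + 1 := by
    simp only [dot] at h1; linarith
  have hcs := sq_sum_le_card_mul_sum_sq (s := Finset.univ) (f := fun i : Fin 8 => x i.succ)
  simp only [Finset.card_univ, Fintype.card_fin, sq, hs, hq] at hcs
  push_cast at hcs
  have hlo : -1 ≤ x 0 := by nlinarith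
  have hhi : x 0 ≤ 7 := by nlinarith
  have hprod : ∀ a : ℤ, ∑ i : Fin 8, (x i.succ - a) * (x i.succ - (a + 1)) =
      x 0 * x 0 + 1 - (2 * a + 1) * (1 - 3 * x 0) + 8 * a * (a + 1) := fun a => by
    have : ∀ i : Fin 8, (x i.succ - a) * (x i.succ - (a + 1)) =
        x i.succ * x i.succ - (2 * a + 1) * x i.succ + a * (a + 1) := fun i => by ring
    simp only [this, Finset.sum_add_distrib, Finset.sum_sub_distrib, ← Finset.mul_sum, hs, hq,
      Finset.sum_const, Finset.card_univ, Fintype.card_fin]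
    ring
  have hnonneg : ∀ a : ℤ, 0 ≤ ∑ i : Fin 8, (x i.succ - a) * (x i.succ - (a + 1)) := fun a =>
    Finset.sum_nonneg fun _ _ => sub_mul_sub_add_one_nonneg _ _
  have two : ∀ a : ℤ, x 0 * x 0 + 1 - (2 * a + 1) * (1 - 3 * x 0) + 8 * a * (a + 1) = 0 →
      ∀ i : Fin 8, x i.succ ∈ [a, a + 1] := fun a h i => by
    have := eq_or_eq_of_sum_eq_zero (x := fun i => x i.succ) (a := a) ((hprod a).trans h) i
    simpa using this
  generalize x 0 = k at *
  interval_cases k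
  · have := hnonneg 0; rw [hprod] at this; norm_num at this
  · exact ⟨(0, [0, 1]), by decide, rfl, two 0 (by norm_num)⟩
  · exact ⟨(1, [-1, 0]), by decide, rfl, two (-1) (by norm_num)⟩
  · exact ⟨(2, [-1, 0]), by decide, rfl, two (-1) (by norm_num)⟩
  · refine ⟨(3, [-2, -1, 0]), by decide, rfl, fun i => ?_⟩
    have hsum : ∑ i : Fin 8, (x i.succ + 1) ^ 2 = 2 := by
      have : ∀ i : Fin 8, (x i.succ + 1) ^ 2 = x i.succ * x i.succ + 2 * x i.succ + 1 :=
        fun i => by ring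
      simp only [this, Finset.sum_add_distrib, ← Finset.mul_sum, hs, hq, Finset.sum_const,
        Finset.card_univ, Fintype.card_fin]
      norm_num
    have hi : (x i.succ + 1) ^ 2 ≤ 2 := hsum ▸
      Finset.single_le_sum (f := fun i : Fin 8 => (x i.succ + 1) ^ 2)
        (fun j _ => sq_nonneg _) (Finset.mem_univ i)
    have h1 : x i.succ ≤ 0 := by nlinarith
    have h2 : -2 ≤ x i.succ := by nlinarith
    simp only [List.mem_cons, List.not_mem_nil, or_false]
    lia
  · exact ⟨(4, [-2, -1]), by decide, rfl, two (-2) (by norm_num)⟩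
  · exact ⟨(5, [-2, -1]), by decide, rfl, two (-2) (by norm_num)⟩
  · exact ⟨(6, [-3, -2]), by decide, rfl, two (-3) (by norm_num)⟩
  · have := hnonneg (-3); rw [hprod] at this; norm_num at this

theorem IsExceptional.ofFn_mem {x : Fin 9 → ℤ} (hx : IsExceptional x) :
    List.ofFn x ∈ exceptionalList := by
  obtain ⟨t, ht, h0, hi⟩ := hx.mem_degreeTable
  obtain ⟨h1, h2⟩ := hx
  rw [dot_KK_right, h0] at h2
  rw [dot, h0] at h1
  refine List.mem_flatMap.2 ⟨t, ht, List.mem_map.2 ⟨List.ofFn fun i : Fin 8 => x i.succ, ?_, ?_⟩⟩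
  · convert ofFn_mem_listsWithSums (fun i : Fin 8 => x i.succ) hi using 1
    congr 1 <;> linarith
  · rw [← h0, List.ofFn_succ (f := x)]

instance (x : Fin 9 → ℤ) : Decidable (IsExceptional x) :=
  inferInstanceAs (Decidable (_ ∧ _))

/-! ### The standard configurations -/

/-- Four pairwise orthogonal roots `E_{2i+1} - E_{2i+2}`, shifted by `-K`. -/
def stdP (i : Fin 4) : Fin 9 → ℤ :=
  Fin.cons 3 fun m => if finProdFinEquiv.symm m = (i, (0 : Fin 2)) then 0
    else if finProdFinEquiv.symm m = (i, (1 : Fin 2)) then -2 else -1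

/-- The four roots orthogonal to those of `stdP`, shifted by `-K`. -/
def stdQ (i : Fin 4) : Fin 9 → ℤ :=
  Fin.cons 5 fun m : Fin 8 => if (finProdFinEquiv.symm m : Fin 4 × Fin 2).1 = i then -1 else -2

theorem stdP_exceptional : ∀ i, IsExceptional (stdP i) := by decide +kernel

theorem stdQ_exceptional : ∀ i, IsExceptional (stdQ i) := by decide +kernel

theorem dot_stdP_stdP : ∀ i j, i ≠ j → dot (stdP i) (stdP j) = 1 := by decide +kernel

theorem dot_stdQ_stdQ : ∀ i j, i ≠ j → dot (stdQ i) (stdQ j) = 1 := by decide +kernel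

theorem dot_stdP_stdQ : ∀ i j, dot (stdP i) (stdQ j) = 1 := by decide +kernel

theorem joining_vector_check : ∀ l ∈ exceptionalList, ∀ k : Fin 4,
    (∀ i < k, listDot (List.ofFn (stdP i)) l = 1) →
    (k = 3 → listDot (List.ofFn (stdQ 3)) l = 1) → listDot l (List.ofFn (stdP k)) = 1 →
    ∃ b ∈ exceptionalList, listDot l b = 0 ∧ listDot b (List.ofFn (stdP k)) = 2 ∧
      (∀ i < k, listDot (List.ofFn (stdP i)) b = 1) := by
  decide +kernel

theorem third_complement_check : ∀ l ∈ exceptionalList,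
    (∀ i < (3 : Fin 4), listDot (List.ofFn (stdP i)) l = 1) →
    listDot (List.ofFn (stdQ 3)) l = -1 ∨ listDot (List.ofFn (stdQ 3)) l = 1 ∨
      listDot (List.ofFn (stdQ 3)) l = 3 := by
  decide +kernel

theorem fourth_complement_check : ∀ l ∈ exceptionalList,
    (∀ i : Fin 4, listDot (List.ofFn (stdP i)) l = 1) →
    ∃ j, listDot (List.ofFn (stdQ j)) l = -1 ∨ listDot (List.ofFn (stdQ j)) l = 3 := by
  decide +kernel

theorem isExceptional_of_mem_exceptionalList : ∀ l ∈ exceptionalList,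
    IsExceptional (fun i => l.getD i 0) ∧ List.ofFn (fun i : Fin 9 => l.getD i 0) = l := by
  decide +kernel

theorem exists_joining_vector {x : Fin 9 → ℤ} (hx : IsExceptional x) (k : Fin 4)
    (h : ∀ i < k, dot (stdP i) x = 1) (h3 : k = 3 → dot (stdQ 3) x = 1)
    (hk : dot x (stdP k) = 1) :
    ∃ b, IsExceptional b ∧ (∀ i < k, dot (stdP i) b = 1) ∧ dot x b = 0 ∧
      dot b (stdP k) = 2 := by
  simp only [dot_eq_listDot] at h h3 hk ⊢
  obtain ⟨b, hb, hb1, hb2, hb3⟩ := joining_vector_check _ hx.ofFn_mem k h h3 hk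
  obtain ⟨hb', e⟩ := isExceptional_of_mem_exceptionalList b hb
  exact ⟨_, hb', by rwa [e], by rwa [e], by rwa [e]⟩

theorem eq_or_eq_partner {x p : Fin 9 → ℤ} (hx : IsExceptional x) (hp : IsExceptional p)
    (h : dot p x = -1 ∨ dot p x = 3) : x = p ∨ x = partner p := by
  rw [dot_comm_s10] at h
  exact h.imp (hx.neg_one_le_dot hp).2 (hx.dot_le_three hp).2

theorem third_complement {x : Fin 9 → ℤ} (hx : IsExceptional x)
    (h : ∀ i < (3 : Fin 4), dot (stdP i) x = 1) :
    dot (stdQ 3) x = 1 ∨ x = stdQ 3 ∨ x = partner (stdQ 3) := by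
  have := third_complement_check _ hx.ofFn_mem
  simp only [← dot_eq_listDot] at this
  rcases this h with h | h | h
  · exact .inr (eq_or_eq_partner hx (stdQ_exceptional 3) (.inl h))
  · exact .inl h
  · exact .inr (eq_or_eq_partner hx (stdQ_exceptional 3) (.inr h))

theorem fourth_complement {x : Fin 9 → ℤ} (hx : IsExceptional x)
    (h : ∀ i, dot (stdP i) x = 1) : ∃ j, x = stdQ j ∨ x = partner (stdQ j) := by
  have := fourth_complement_check _ hx.ofFn_mem
  simp only [← dot_eq_listDot] at this
  obtain ⟨j, hj⟩ := this h
  exact ⟨j, eq_or_eq_partner hx (stdQ_exceptional j) hj⟩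

/-- The isometry permuting the four pairs of coordinates. -/
def pairPerm (π : Equiv.Perm (Fin 4)) : (Fin 9 → ℤ) ≃ₗ[ℤ] (Fin 9 → ℤ) :=
  LinearEquiv.funCongrLeft ℤ ℤ <| Equiv.Perm.decomposeFin.symm
    (0, finProdFinEquiv.symm.trans <|
      (Equiv.prodCongr π.symm (Equiv.refl (Fin 2))).trans finProdFinEquiv)

theorem funCongrLeft_mem_fixer (ρ : Equiv.Perm (Fin 8)) :
    LinearEquiv.funCongrLeft ℤ ℤ (Equiv.Perm.decomposeFin.symm ((0 : Fin 9), ρ)) ∈ fixer ∅ := by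
  refine ⟨fun x y => ?_, ?_, fun z hz => hz.elim⟩
  · simp only [dot, LinearEquiv.funCongrLeft_apply, LinearMap.funLeft_apply,
      Equiv.Perm.decomposeFin_symm_apply_zero, Equiv.Perm.decomposeFin_symm_apply_succ,
      Equiv.swap_self, Equiv.refl_apply]
    rw [Equiv.sum_comp ρ fun i => x i.succ * y i.succ]
  · have h : ∀ i : Fin 8, KK i.succ = 1 := by decide
    funext i
    refine Fin.cases ?_ (fun j => ?_) i
    · simp [LinearEquiv.funCongrLeft_apply, LinearMap.funLeft_apply]
    · simp [LinearEquiv.funCongrLeft_apply, LinearMap.funLeft_apply, h]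

theorem pairPerm_stdP : ∀ π i, pairPerm π (stdP i) = stdP (π i) := by decide +kernel

theorem pairPerm_stdQ : ∀ π i, pairPerm π (stdQ i) = stdQ (π i) := by decide +kernel

/-! ### Frames -/

/-- A set of exceptional vectors which pairwise meet once. -/
def IsFrame (S : Set (Fin 9 → ℤ)) : Prop :=
  (∀ x ∈ S, IsExceptional x) ∧ S.Pairwise fun x y => dot x y = 1

/-- Two sets are congruent if an isometry fixing `K` maps one onto the other. -/
def WCongruent (S T : Set (Fin 9 → ℤ)) : Prop := ∃ g ∈ fixer ∅, g '' S = T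

namespace WCongruent

variable {S T U : Set (Fin 9 → ℤ)}

theorem refl (S : Set (Fin 9 → ℤ)) : WCongruent S S := ⟨1, one_mem _, Set.image_id S⟩

theorem symm : WCongruent S T → WCongruent T S := by
  rintro ⟨g, hg, rfl⟩
  exact ⟨g⁻¹, inv_mem hg, g.toEquiv.symm_image_image S⟩

theorem trans : WCongruent S T → WCongruent T U → WCongruent S U := by
  rintro ⟨g, hg, rfl⟩ ⟨h, hh, rfl⟩
  exact ⟨h * g, mul_mem hh hg, Set.image_comp h g S⟩

theorem isFrame (h : WCongruent S T) (hS : IsFrame S) : IsFrame T := by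
  obtain ⟨g, hg, rfl⟩ := h
  refine ⟨?_, ?_⟩
  · rintro _ ⟨x, hx, rfl⟩
    exact (hS.1 x hx).map hg
  · rintro _ ⟨x, hx, rfl⟩ _ ⟨y, hy, rfl⟩ hxy
    exact (hg.1 x y).trans (hS.2 hx hy fun e => hxy (congrArg g e))

theorem ncard_eq (h : WCongruent S T) : T.ncard = S.ncard := by
  obtain ⟨g, -, rfl⟩ := h
  exact Set.ncard_image_of_injective S g.injective

end WCongruent

/-- The first `k` vectors of `stdP`. -/
def initialP (k : ℕ) : Set (Fin 9 → ℤ) := stdP '' {i | (i : ℕ) < k}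

theorem stdP_injective : Function.Injective stdP := by decide +kernel

theorem stdQ_injective : Function.Injective stdQ := by decide +kernel

theorem ncard_initialP {k : ℕ} (hk : k ≤ 4) : (initialP k).ncard = k := by
  rw [initialP, Set.ncard_image_of_injective _ stdP_injective, Set.ncard_eq_toFinset_card']
  interval_cases k <;> decide

theorem finite_initialP (k : ℕ) : (initialP k).Finite := (Set.toFinite _).image _

theorem initialP_succ (k : Fin 4) : initialP (k + 1) = insert (stdP k) (initialP k) := by
  rw [initialP, initialP, ← Set.image_insert_eq]
  congr 1
  ext i
  simp only [Set.mem_ofPred_eq, Set.mem_insert_iff, Fin.ext_iff]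
  lia

theorem finite_of_isFrame {S : Set (Fin 9 → ℤ)} (hS : IsFrame S) : S.Finite := by
  refine Set.Finite.of_finite_image (f := List.ofFn)
    (exceptionalList.finite_toSet.subset ?_) List.ofFn_injective.injOn
  rintro _ ⟨x, hx, rfl⟩
  exact (hS.1 x hx).ofFn_mem

theorem exists_congruent_succ {S : Set (Fin 9 → ℤ)} (hS : IsFrame S) (k : Fin 4)
    (hkS : initialP k ⊆ S) {x : Fin 9 → ℤ} (hx : x ∈ S) (hxk : x ∉ initialP k)
    (h3 : k = 3 → dot (stdQ 3) x = 1) :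
    ∃ T, WCongruent S T ∧ initialP (k + 1) ⊆ T := by
  have hPx : ∀ z ∈ initialP k, dot z x = 1 := fun z hz =>
    hS.2 (hkS hz) hx fun e => hxk (e ▸ hz)
  obtain ⟨g, hg, hgx⟩ := exists_map_eq (hS.1 x hx) (stdP_exceptional k) (P := initialP k)
    (fun z hz => hS.1 z (hkS hz)) hPx
    (by rintro _ ⟨i, hi, rfl⟩; exact dot_stdP_stdP i k (Fin.ne_of_lt hi)) fun h => by
      obtain ⟨b, hb, hb1, hb2⟩ := exists_joining_vector (hS.1 x hx) k
        (fun i hi => hPx _ ⟨i, hi, rfl⟩) h3 h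
      refine ⟨b, hb, ?_, hb2⟩
      rintro _ ⟨i, hi, rfl⟩
      exact hb1 i hi
  refine ⟨g '' S, ⟨g, fixer_anti (Set.empty_subset _) hg, rfl⟩, ?_⟩
  rw [initialP_succ]
  refine Set.insert_subset ⟨x, hx, hgx⟩ fun z hz => ⟨z, hkS hz, hg.2.2 z hz⟩

theorem exists_congruent_initialP {S : Set (Fin 9 → ℤ)} (hS : IsFrame S) {k : ℕ} (hk : k ≤ 3)
    (hkS : k ≤ S.ncard) : ∃ T, WCongruent S T ∧ initialP k ⊆ T := by
  induction k with
  | zero => exact ⟨S, .refl S, by simp [initialP]⟩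
  | succ k ih =>
    obtain ⟨T, hST, hT⟩ := ih (by lia) (by lia)
    obtain ⟨x, hxT, hx⟩ := Set.exists_mem_notMem_of_ncard_lt_ncard
      (s := initialP k) (t := T) (by rw [ncard_initialP (by lia), hST.ncard_eq]; lia)
      (finite_initialP k)
    obtain ⟨U, hTU, hU⟩ := exists_congruent_succ (hST.isFrame hS) ⟨k, by lia⟩ hT hxT hx
      fun e => by simp [Fin.ext_iff] at e; lia
    exact ⟨U, hST.trans hTU, hU⟩

theorem exists_congruent_initialP_four {S : Set (Fin 9 → ℤ)} (hS : IsFrame S)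
    (h5 : 5 ≤ S.ncard) : ∃ T, WCongruent S T ∧ initialP 4 ⊆ T := by
  obtain ⟨T, hST, hT⟩ := exists_congruent_initialP hS le_rfl (by lia)
  have hTF := hST.isFrame hS
  have hfin := finite_of_isFrame hTF
  have hcard : 1 < (T \ initialP 3).ncard := by
    have := Set.le_ncard_sdiff (initialP 3) T (finite_initialP 3)
    rw [ncard_initialP (by lia), hST.ncard_eq] at this
    lia
  obtain ⟨x, y, hx, hy, hxy⟩ := (Set.one_lt_ncard_iff hfin.sdiff).1 hcard
  have hcompl : ∀ z ∈ T \ initialP 3,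
      dot (stdQ 3) z = 1 ∨ z = stdQ 3 ∨ z = partner (stdQ 3) := fun z hz =>
    third_complement (hTF.1 z hz.1) fun i hi =>
      hTF.2 (hT ⟨i, hi, rfl⟩) hz.1 fun e => hz.2 (e ▸ ⟨i, hi, rfl⟩)
  have h3 : ∃ z ∈ T \ initialP 3, dot (stdQ 3) z = 1 := by
    by_contra! hcon
    have hdot := hTF.2 hx.1 hy.1 hxy
    have hQ := stdQ_exceptional 3
    have e1 := hQ.partner_dot (x := stdQ 3)
    rw [hQ.1] at e1
    rcases (hcompl x hx).resolve_left (hcon x hx) with rfl | rfl <;>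
      rcases (hcompl y hy).resolve_left (hcon y hy) with rfl | rfl
    · exact hxy rfl
    · lia
    · rw [dot_comm_s10] at hdot; lia
    · exact hxy rfl
  obtain ⟨z, hz, hz3⟩ := h3
  obtain ⟨U, hTU, hU⟩ := exists_congruent_succ hTF 3 hT hz.1 hz.2 fun _ => hz3
  exact ⟨U, hST.trans hTU, hU⟩

/-- Reflections in the vectors of `stdQ` make a frame containing `stdP` avoid their partners. -/
theorem exists_congruent_avoiding {S : Set (Fin 9 → ℤ)} (hS : IsFrame S)
    (h4 : initialP 4 ⊆ S) {k : ℕ} (hk : k ≤ 4) :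
    ∃ T, WCongruent S T ∧ initialP 4 ⊆ T ∧ ∀ j : Fin 4, (j : ℕ) < k → partner (stdQ j) ∉ T := by
  induction k with
  | zero => exact ⟨S, .refl S, h4, by simp⟩
  | succ k ih =>
    obtain ⟨T, hST, hT, hav⟩ := ih (by lia)
    have hTF := hST.isFrame hS
    set i : Fin 4 := ⟨k, by lia⟩
    by_cases hmem : partner (stdQ i) ∈ T
    · obtain ⟨g, hg, hgq, -⟩ := exists_swap_partner (stdQ_exceptional i)
        (P := initialP 4 ∪ stdQ '' {j | j ≠ i}) <| by
        rintro _ (⟨j, -, rfl⟩ | ⟨j, hj, rfl⟩)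
        · exact ⟨stdP_exceptional j, dot_stdP_stdQ j i⟩
        · exact ⟨stdQ_exceptional j, dot_stdQ_stdQ j i hj⟩
      refine ⟨g '' T, hST.trans ⟨g, fixer_anti (Set.empty_subset _) hg, rfl⟩,
        fun z hz => ⟨z, hT hz, hg.2.2 z (.inl hz)⟩, ?_⟩
      rintro j hj ⟨z, hz, hgz⟩
      by_cases hji : j = i
      · rw [hji] at hgz
        have hzq : z = stdQ i := g.injective <| by
          rw [hgz, ← partner_partner (g (stdQ i)), ← map_partner hg, hgq]
        have hd := (stdQ_exceptional i).partner_dot (x := stdQ i)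
        rw [(stdQ_exceptional i).1] at hd
        have hne : stdQ i ≠ partner (stdQ i) := fun e => by
          rw [← e, (stdQ_exceptional i).1] at hd; lia
        have := hTF.2 (hzq ▸ hz) hmem hne
        lia
      · have hzq : z = partner (stdQ j) := g.injective <| by
          rw [hgz, map_partner hg, hg.2.2 _ (.inr ⟨j, hji, rfl⟩)]
        have : (j : ℕ) ≠ k := fun e => hji (Fin.ext e)
        exact hav j (by lia) (hzq ▸ hz)
    · refine ⟨T, hST, hT, fun j hj => ?_⟩
      by_cases hji : j = i
      · rwa [hji]
      · have : (j : ℕ) ≠ k := fun e => hji (Fin.ext e)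
        exact hav j (by lia)

theorem exists_perm_map_eq : ∀ A : Finset (Fin 4), ∃ π : Equiv.Perm (Fin 4),
    ∀ j : Fin 4, (j : ℕ) < A.card ↔ π.symm j ∈ A := by decide +kernel

/-- The standard frame with `n` elements (for `n ≠ 4`). -/
def stdFrame (n : ℕ) : Set (Fin 9 → ℤ) := initialP n ∪ stdQ '' {j | (j : ℕ) + 4 < n}

theorem IsFrame.congruent_stdFrame_of_le_three {S : Set (Fin 9 → ℤ)} (hS : IsFrame S)
    (h3 : S.ncard ≤ 3) : WCongruent S (stdFrame S.ncard) := by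
  obtain ⟨T, hST, hT⟩ := exists_congruent_initialP hS h3 le_rfl
  have : initialP S.ncard = T := Set.eq_of_subset_of_ncard_le hT
    (by rw [ncard_initialP (by lia), hST.ncard_eq]) (finite_of_isFrame (hST.isFrame hS))
  have hQ : {j : Fin 4 | (j : ℕ) + 4 < S.ncard} = ∅ := by ext j; simp; lia
  rwa [stdFrame, hQ, Set.image_empty, Set.union_empty, this]

theorem image_initialP_four (π : Equiv.Perm (Fin 4)) :
    pairPerm π '' initialP 4 = initialP 4 := by
  have : {i : Fin 4 | (i : ℕ) < 4} = Set.univ := by ext i; simp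
  rw [initialP, this, Set.image_image]
  simp only [pairPerm_stdP, Set.image_univ]
  exact π.surjective.range_comp stdP

theorem IsFrame.congruent_stdFrame_of_five_le {S : Set (Fin 9 → ℤ)} (hS : IsFrame S)
    (h5 : 5 ≤ S.ncard) : WCongruent S (stdFrame S.ncard) := by
  classical
  obtain ⟨T, hST, hT⟩ := exists_congruent_initialP_four hS h5
  obtain ⟨U, hTU, hU, hav⟩ := exists_congruent_avoiding (hST.isFrame hS) hT le_rfl
  have hSU := hST.trans hTU
  have hUF := hSU.isFrame hS
  set A : Finset (Fin 4) := Finset.univ.filter fun j => stdQ j ∈ U with hA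
  have hdisj : Disjoint (initialP 4) (stdQ '' (A : Set (Fin 4))) := by
    rw [Set.disjoint_left]
    rintro _ ⟨i, -, rfl⟩ ⟨j, -, hj⟩
    have := dot_stdP_stdQ i j
    rw [hj, (stdP_exceptional i).1] at this
    lia
  have hUeq : U = initialP 4 ∪ stdQ '' (A : Set (Fin 4)) := by
    refine Set.Subset.antisymm (fun x hx => ?_) (Set.union_subset hU ?_)
    · by_cases hxP : x ∈ initialP 4
      · exact .inl hxP
      · obtain ⟨j, rfl | rfl⟩ := fourth_complement (hUF.1 x hx) fun i =>
          hUF.2 (hU ⟨i, i.isLt, rfl⟩) hx fun e => hxP (e ▸ ⟨i, i.isLt, rfl⟩)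
        · exact .inr ⟨j, by simpa [hA] using hx, rfl⟩
        · exact absurd hx (hav j j.isLt)
    · rintro _ ⟨j, hj, rfl⟩
      simpa [hA] using hj
  have hcard : S.ncard = 4 + A.card := by
    rw [← hSU.ncard_eq, hUeq, Set.ncard_union_eq hdisj (finite_initialP 4) (Set.toFinite _),
      ncard_initialP le_rfl, Set.ncard_image_of_injective _ stdQ_injective,
      Set.ncard_coe_finset]
  obtain ⟨π, hπ⟩ := exists_perm_map_eq A
  refine hSU.trans ⟨pairPerm π, funCongrLeft_mem_fixer _, ?_⟩
  have hP : initialP S.ncard = initialP 4 := by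
    rw [initialP, initialP]
    congr 1
    ext i
    simp only [Set.mem_ofPred_eq]
    lia
  have hQ : {j : Fin 4 | (j : ℕ) + 4 < S.ncard} = π '' (A : Set (Fin 4)) := by
    ext j
    rw [Equiv.image_eq_preimage_symm]
    simp only [Set.mem_ofPred_eq, Set.mem_preimage, Finset.mem_coe, ← hπ, hcard]
    lia
  rw [stdFrame, hP, hQ, hUeq, Set.image_union, image_initialP_four, Set.image_image,
    Set.image_image]
  simp only [pairPerm_stdQ]

theorem IsFrame.congruent {S T : Set (Fin 9 → ℤ)} (hS : IsFrame S) (hT : IsFrame T)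
    (h : S.ncard = T.ncard) (h4 : S.ncard ≠ 4) : WCongruent S T := by
  have key : ∀ U, IsFrame U → U.ncard ≠ 4 → WCongruent U (stdFrame U.ncard) := fun U hU h4 => by
    rcases le_or_gt U.ncard 3 with h3 | h3
    · exact hU.congruent_stdFrame_of_le_three h3
    · exact hU.congruent_stdFrame_of_five_le (by lia)
  exact (key S hS h4).trans (h ▸ (key T hT (h ▸ h4)).symm)

theorem isFrame_range {ι : Type*} {e : ι → Fin 9 → ℤ} (he : ∀ i, IsExceptional (e i))
    (hee : ∀ i j, i ≠ j → dot (e i) (e j) = 1) : IsFrame (Set.range e) := by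
  refine ⟨Set.forall_mem_range.2 he, ?_⟩
  rintro _ ⟨i, rfl⟩ _ ⟨j, rfl⟩ hij
  exact hee i j fun h => hij (congrArg e h)

theorem ncard_range {n : ℕ} {e : Fin n → Fin 9 → ℤ} (he : ∀ i, IsExceptional (e i))
    (hee : ∀ i j, i ≠ j → dot (e i) (e j) = 1) : (Set.range e).ncard = n := by
  have hinj : Function.Injective e := fun i j hij => by
    by_contra hne
    have := hee i j hne
    rw [hij, (he j).1] at this
    lia
  rw [← Set.image_univ, Set.ncard_image_of_injective _ hinj, Set.ncard_univ, Nat.card_fin]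

theorem range_eq_partner_image {ι : Type*} {e c : ι → Fin 9 → ℤ}
    (he : ∀ i, IsExceptional (e i)) (hc : ∀ i, IsExceptional (c i))
    (hec : ∀ i, dot (e i) (c i) = 3) : Set.range c = partner '' Set.range e := by
  rw [← Set.range_comp]
  congr 1
  funext i
  exact ((hc i).dot_le_three (he i)).2 (by rw [dot_comm_s10, hec])

/-- For `n ∈ {2,3,5,6,7,8}`, the group `W` acts transitively on the configurations of `n`
pairwise partnered exceptional vectors: given `e₁,…,eₙ,c₁,…,cₙ` and `f₁,…,fₙ,d₁,…,dₙ` in `C`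
with `eᵢ·cᵢ = 3 = fᵢ·dᵢ` and all other mutual products equal to 1, some `σ ∈ W` maps the set
`{e₁,…,eₙ,c₁,…,cₙ}` onto `{f₁,…,fₙ,d₁,…,dₙ}`. -/
theorem stmt_10 (n : ℕ) (hn : n ∈ ({2, 3, 5, 6, 7, 8} : Set ℕ))
    (e c f d : Fin n → Fin 9 → ℤ)
    (he : ∀ i, IsExceptional (e i)) (hc : ∀ i, IsExceptional (c i))
    (hf : ∀ i, IsExceptional (f i)) (hd : ∀ i, IsExceptional (d i))
    (hec : ∀ i, dot (e i) (c i) = 3)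
    (hee : ∀ i j, i ≠ j → dot (e i) (e j) = 1)
    (hec' : ∀ i j, i ≠ j → dot (e i) (c j) = 1)
    (hcc : ∀ i j, i ≠ j → dot (c i) (c j) = 1)
    (hfd : ∀ i, dot (f i) (d i) = 3)
    (hff : ∀ i j, i ≠ j → dot (f i) (f j) = 1)
    (hfd' : ∀ i j, i ≠ j → dot (f i) (d j) = 1)
    (hdd : ∀ i j, i ≠ j → dot (d i) (d j) = 1) :
    ∃ σ : (Fin 9 → ℤ) → (Fin 9 → ℤ), MemW σ ∧
      σ '' (Set.range e ∪ Set.range c) = Set.range f ∪ Set.range d := by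
  obtain ⟨g, hg, hgS⟩ := (isFrame_range he hee).congruent (isFrame_range hf hff)
    (by rw [ncard_range he hee, ncard_range hf hff])
    (by rw [ncard_range he hee]; rintro rfl; simp at hn)
  refine ⟨g, memW_of_mem_fixer hg, ?_⟩
  rw [range_eq_partner_image he hc hec, range_eq_partner_image hf hd hfd, ← hgS,
    Set.image_union, Set.image_image, Set.image_image]
  simp only [map_partner hg]
end
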